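/- arXiv:math/0308268 — 5 statements merged into one kernel-verified Lean document; each statement's English description precedes it below -/
import Mathlib

section
/- The function d is an ultrametric on the rational numbers: for all x, y, z ∈ ℚ one has d(x,y) = 0 if and only if x = y; d(x,y) = d(y,x); and d(x,z) ≤ max(d(x,y), d(y,z)). In particular d is a metric on ℚ. -/
/-- The metric `d` on the reals: for `x ≠ y`,
`d(x,y) = sup {1/(|p|+q) : p ∈ ℤ, q ≥ 1, gcd(p,q) = 1, min x y ≤ p/q ≤ max x y}`,
and `d(x,x) = 0`. -/
noncomputable def dmet (x y : ℝ) : ℝ :=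
  if x = y then 0 else
    sSup {r : ℝ | ∃ (p : ℤ) (q : ℕ), 0 < q ∧ Int.gcd p q = 1 ∧
      min x y ≤ (p : ℝ) / q ∧ (p : ℝ) / q ≤ max x y ∧ r = 1 / (|(p : ℝ)| + q)}

/-- The values `1/(|p|+q)` over the reduced fractions `p/q` between `x` and `y`. -/
def dmetValues (x y : ℝ) : Set ℝ :=
  {r : ℝ | ∃ (p : ℤ) (q : ℕ), 0 < q ∧ Int.gcd p q = 1 ∧
      min x y ≤ (p : ℝ) / q ∧ (p : ℝ) / q ≤ max x y ∧ r = 1 / (|(p : ℝ)| + q)}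

theorem dmet_self (x : ℝ) : dmet x x = 0 := if_pos rfl

theorem dmet_of_ne {x y : ℝ} (h : x ≠ y) : dmet x y = sSup (dmetValues x y) := if_neg h

theorem dmet_comm (x y : ℝ) : dmet x y = dmet y x := by
  simp only [dmet, eq_comm (a := x), min_comm x, max_comm x]

theorem pos_of_mem_dmetValues {x y r : ℝ} (hr : r ∈ dmetValues x y) : 0 < r := by
  obtain ⟨p, q, hq, -, -, -, rfl⟩ := hr
  positivity

theorem bddAbove_dmetValues (x y : ℝ) : BddAbove (dmetValues x y) := by
  refine ⟨1, ?_⟩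
  rintro _ ⟨p, q, hq, -, -, -, rfl⟩
  have hq' : (1 : ℝ) ≤ q := by exact_mod_cast hq
  exact div_le_one_of_le₀ (by linarith [abs_nonneg (p : ℝ)]) (by positivity)

theorem dmetValues_nonempty {x y : ℝ} (h : x ≠ y) : (dmetValues x y).Nonempty := by
  obtain ⟨s, hs₁, hs₂⟩ := exists_rat_btwn (min_lt_max.2 h)
  rw [Rat.cast_def] at hs₁ hs₂
  exact ⟨_, s.num, s.den, s.pos, s.reduced, hs₁.le, hs₂.le, rfl⟩

theorem le_dmet {x y r : ℝ} (h : x ≠ y) (hr : r ∈ dmetValues x y) : r ≤ dmet x y :=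
  dmet_of_ne h ▸ le_csSup (bddAbove_dmetValues x y) hr

theorem dmet_pos {x y : ℝ} (h : x ≠ y) : 0 < dmet x y :=
  have ⟨_, hr⟩ := dmetValues_nonempty h
  (pos_of_mem_dmetValues hr).trans_le (le_dmet h hr)

theorem dmet_eq_zero_iff {x y : ℝ} : dmet x y = 0 ↔ x = y := by
  refine ⟨fun h => ?_, fun h => h ▸ dmet_self x⟩
  by_contra hne
  exact (dmet_pos hne).ne' h

theorem dmet_nonneg (x y : ℝ) : 0 ≤ dmet x y := by
  obtain rfl | h := eq_or_ne x y
  · exact (dmet_self x).ge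
  · exact (dmet_pos h).le

theorem dmetValues_subset_union (x y z : ℝ) :
    dmetValues x z ⊆ dmetValues x y ∪ dmetValues y z := by
  rintro _ ⟨p, q, hq, hpq, h₁, h₂, rfl⟩
  have h : (min x y ≤ (p : ℝ) / q ∧ (p : ℝ) / q ≤ max x y) ∨
      (min y z ≤ (p : ℝ) / q ∧ (p : ℝ) / q ≤ max y z) := by
    grind
  exact h.imp (fun h => ⟨p, q, hq, hpq, h.1, h.2, rfl⟩) fun h => ⟨p, q, hq, hpq, h.1, h.2, rfl⟩

theorem dmet_le_max (x y z : ℝ) : dmet x z ≤ max (dmet x y) (dmet y z) := by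
  obtain rfl | hxz := eq_or_ne x z
  · exact (dmet_self x).trans_le (le_max_of_le_left (dmet_nonneg x y))
  obtain rfl | hxy := eq_or_ne x y
  · exact le_max_right _ _
  obtain rfl | hyz := eq_or_ne y z
  · exact le_max_left _ _
  rw [dmet_of_ne hxz]
  refine csSup_le (dmetValues_nonempty hxz) fun r hr => ?_
  exact (dmetValues_subset_union x y z hr).elim
    (fun h => le_max_of_le_left (le_dmet hxy h)) fun h => le_max_of_le_right (le_dmet hyz h)

/-- `d` is an ultrametric (in particular a metric) on the rational numbers. -/
theorem dmet_isUltrametric_on_rat :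
    (∀ x y : ℚ, dmet (x : ℝ) (y : ℝ) = 0 ↔ x = y) ∧
    (∀ x y : ℚ, dmet (x : ℝ) (y : ℝ) = dmet (y : ℝ) (x : ℝ)) ∧
    (∀ x y z : ℚ, dmet (x : ℝ) (z : ℝ) ≤ max (dmet (x : ℝ) (y : ℝ)) (dmet (y : ℝ) (z : ℝ))) :=
  ⟨fun _ _ => dmet_eq_zero_iff.trans Rat.cast_inj, fun _ _ => dmet_comm _ _,
    fun _ _ _ => dmet_le_max _ _ _⟩
end

section
/- The function δ is an ultrametric on the set S = {x ∈ [0,1] : x ∉ ℚ} of irrational numbers in [0,1]: for all x, y, z ∈ S one has δ(x,y) = 0 if and only if x = y; δ(x,y) = δ(y,x); and δ(x,z) ≤ max(δ(x,y), δ(y,z)). In particular δ is a metric on S. -/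
/-- The metric `δ` on the reals: for `x ≠ y`,
`δ(x,y) = sup {1/q : q ≥ 1, ∃ p ∈ ℤ, gcd(p,q) = 1, min x y ≤ p/q ≤ max x y}`,
and `δ(x,x) = 0`. -/
noncomputable def deltamet (x y : ℝ) : ℝ :=
  if x = y then 0 else
    sSup {r : ℝ | ∃ q : ℕ, 0 < q ∧ (∃ p : ℤ, Int.gcd p q = 1 ∧
      min x y ≤ (p : ℝ) / q ∧ (p : ℝ) / q ≤ max x y) ∧ r = 1 / (q : ℝ)}

/-- Reduced fractions between two distinct points bound `deltamet` from below. -/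
lemma one_div_le_deltamet {x y : ℝ} (hxy : x ≠ y) {q : ℕ} (hq : 0 < q) {p : ℤ}
    (hpq : Int.gcd p q = 1) (h₁ : min x y ≤ (p : ℝ) / q) (h₂ : (p : ℝ) / q ≤ max x y) :
    1 / (q : ℝ) ≤ deltamet x y := by
  rw [deltamet, if_neg hxy]
  refine le_csSup ⟨1, ?_⟩ ⟨q, hq, ⟨p, hpq, h₁, h₂⟩, rfl⟩
  rintro r ⟨n, hn, -, rfl⟩
  have hn' : (1 : ℝ) ≤ n := by exact_mod_cast hn
  exact (div_le_one (by positivity)).2 hn'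

lemma deltamet_pos {x y : ℝ} (hxy : x ≠ y) : 0 < deltamet x y := by
  obtain ⟨r, h₁, h₂⟩ := exists_rat_btwn (min_lt_max.2 hxy)
  rw [Rat.cast_def] at h₁ h₂
  have hr : (0 : ℝ) < r.den := by exact_mod_cast r.pos
  exact (one_div_pos.2 hr).trans_le
    (one_div_le_deltamet hxy r.pos (by simpa [Int.gcd] using r.reduced) h₁.le h₂.le)

lemma deltamet_self (x : ℝ) : deltamet x x = 0 := if_pos rfl

lemma deltamet_nonneg (x y : ℝ) : 0 ≤ deltamet x y := by
  by_cases hxy : x = y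
  · rw [hxy, deltamet_self]
  · exact (deltamet_pos hxy).le

lemma deltamet_eq_zero_iff {x y : ℝ} : deltamet x y = 0 ↔ x = y := by
  refine ⟨fun h => ?_, fun h => if_pos h⟩
  by_contra hxy
  exact (deltamet_pos hxy).ne' h

lemma deltamet_comm (x y : ℝ) : deltamet x y = deltamet y x := by
  simp only [deltamet, eq_comm (a := x), min_comm x, max_comm x]

/-- The strong triangle inequality for `deltamet`, valid for all real numbers. -/
lemma deltamet_le_max (x y z : ℝ) : deltamet x z ≤ max (deltamet x y) (deltamet y z) := by
  by_cases hxz : x = z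
  · rw [hxz, deltamet_self]
    exact le_max_of_le_left (deltamet_nonneg _ _)
  by_cases hxy : x = y
  · rw [hxy]
    exact le_max_right _ _
  by_cases hyz : y = z
  · rw [hyz]
    exact le_max_left _ _
  rw [deltamet.eq_1 x z, if_neg hxz]
  refine Real.sSup_le ?_ (le_max_of_le_left (deltamet_nonneg _ _))
  rintro r ⟨q, hq, ⟨p, hpq, h₁, h₂⟩, rfl⟩
  have hmem : (p : ℝ) / q ∈ Set.uIcc x y ∪ Set.uIcc y z :=
    Set.uIcc_subset_uIcc_union_uIcc ⟨h₁, h₂⟩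
  rcases hmem with h | h
  · exact le_max_of_le_left (one_div_le_deltamet hxy hq hpq h.1 h.2)
  · exact le_max_of_le_right (one_div_le_deltamet hyz hq hpq h.1 h.2)

/-- `δ` is an ultrametric (in particular a metric) on the set of irrational numbers
in `[0,1]`. -/
theorem deltamet_isUltrametric_on_irrationals :
    (∀ x y : ℝ, x ∈ Set.Icc (0:ℝ) 1 → y ∈ Set.Icc (0:ℝ) 1 → Irrational x → Irrational y →
      (deltamet x y = 0 ↔ x = y)) ∧
    (∀ x y : ℝ, x ∈ Set.Icc (0:ℝ) 1 → y ∈ Set.Icc (0:ℝ) 1 → Irrational x → Irrational y →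
      deltamet x y = deltamet y x) ∧
    (∀ x y z : ℝ, x ∈ Set.Icc (0:ℝ) 1 → y ∈ Set.Icc (0:ℝ) 1 → z ∈ Set.Icc (0:ℝ) 1 →
      Irrational x → Irrational y → Irrational z →
      deltamet x z ≤ max (deltamet x y) (deltamet y z)) :=
  ⟨fun _ _ _ _ _ _ => deltamet_eq_zero_iff, fun x y _ _ _ _ => deltamet_comm x y,
    fun x y z _ _ _ _ _ _ => deltamet_le_max x y z⟩
end

section
/- Let (xₙ) be a sequence of rational numbers. Then (xₙ) is a Cauchy sequence for the metric d (i.e. for every ε > 0 there is N such that d(xₘ, xₙ) < ε for all m, n ≥ N) if and only if at least one of the following holds: (1) (xₙ) converges in ℝ to an irrational number; (2) there is a rational r such that (xₙ) converges to r in ℝ and xₙ > r for all sufficiently large n; (3) there is a rational r such that (xₙ) converges to r in ℝ and xₙ < r for all sufficiently large n; (4) (xₙ) is eventually constant; (5) xₙ → +∞; (6) xₙ → −∞. -/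
open Filter

/-- A rational in the interval spanned by two distinct reals bounds their distance from below. -/
theorem one_div_le_dmet {x y : ℝ} (hxy : x ≠ y) {c : ℚ} (h₁ : min x y ≤ c) (h₂ : c ≤ max x y) :
    1 / (|(c.num : ℝ)| + c.den) ≤ dmet x y := by
  rw [dmet, if_neg hxy]
  refine le_csSup ⟨1, ?_⟩ ⟨c.num, c.den, c.pos, c.reduced, ?_, ?_, rfl⟩
  · rintro _ ⟨p, q, hq, -, -, -, rfl⟩
    have hq' : (1 : ℝ) ≤ q := by exact_mod_cast hq
    have := abs_nonneg (p : ℝ)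
    rw [div_le_one (by linarith)]
    linarith
  · rwa [← Rat.cast_def]
  · rwa [← Rat.cast_def]

/-- If all the rationals between `x` and `y` have height at least `K`, then `d(x,y) ≤ 1/K`. -/
theorem dmet_le_one_div {x y K : ℝ} (hK : 0 < K)
    (h : x ≠ y → ∀ (p : ℤ) (q : ℕ), 0 < q → min x y ≤ (p : ℝ) / q → (p : ℝ) / q ≤ max x y →
      K ≤ |(p : ℝ)| + q) : dmet x y ≤ 1 / K := by
  rw [dmet]
  split_ifs with hxy
  · positivity
  · refine Real.sSup_le ?_ (by positivity)
    rintro _ ⟨p, q, hq, -, h₁, h₂, rfl⟩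
    exact one_div_le_one_div_of_le hK (h hxy p q hq h₁ h₂)

/-- Only finitely many rationals have bounded height. -/
theorem exists_finset_rat_of_height_lt (K : ℕ) :
    ∃ T : Finset ℚ, ∀ (p : ℤ) (q : ℕ), |(p : ℝ)| + q < K → (p : ℚ) / q ∈ T := by
  refine ⟨(Finset.Icc (-(K : ℤ)) K ×ˢ Finset.range K).image fun z => (z.1 : ℚ) / z.2, ?_⟩
  intro p q h
  have h' : |p| + q < K := by exact_mod_cast h
  refine Finset.mem_image.2 ⟨(p, q), ?_, rfl⟩
  have := neg_abs_le p
  have := le_abs_self p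
  have := abs_nonneg p
  simp only [Finset.mem_product, Finset.mem_Icc, Finset.mem_range]
  omega

/-- A sequence of rationals is Cauchy for `d` iff it eventually stays on one side of, or at, every
rational. -/
theorem cauchySeq_dmet_iff_eventually_trichotomy (x : ℕ → ℚ) :
    (∀ ε : ℝ, 0 < ε → ∃ N : ℕ, ∀ m ≥ N, ∀ n ≥ N, dmet (x m : ℝ) (x n : ℝ) < ε) ↔
    ∀ c : ℚ, (∀ᶠ n in atTop, c < x n) ∨ (∀ᶠ n in atTop, x n < c) ∨ ∀ᶠ n in atTop, x n = c := by
  constructor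
  · intro h c
    have hc : (0 : ℝ) < |(c.num : ℝ)| + c.den := by
      have : (0 : ℝ) < c.den := by exact_mod_cast c.pos
      positivity
    obtain ⟨N, hN⟩ := h (1 / (|(c.num : ℝ)| + c.den)) (by positivity)
    have key : ∀ m ≥ N, ∀ n ≥ N, x m ≤ c → c ≤ x n → x m = x n := by
      intro m hm n hn h₁ h₂
      by_contra hne
      refine (hN m hm n hn).not_ge (one_div_le_dmet (by exact_mod_cast hne) ?_ ?_)
      · exact min_le_of_left_le (by exact_mod_cast h₁)
      · exact le_max_of_le_right (by exact_mod_cast h₂)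
    by_cases hlt : ∀ n ≥ N, c < x n
    · exact Or.inl (eventually_atTop.2 ⟨N, hlt⟩)
    by_cases hgt : ∀ n ≥ N, x n < c
    · exact Or.inr (Or.inl (eventually_atTop.2 ⟨N, hgt⟩))
    push Not at hlt hgt
    obtain ⟨m, hm, hmc⟩ := hlt
    obtain ⟨n, hn, hnc⟩ := hgt
    have hmn := key m hm n hn hmc hnc
    refine Or.inr (Or.inr (eventually_atTop.2 ⟨N, fun k hk => ?_⟩))
    rcases le_total (x k) c with hkc | hkc
    · linarith [key k hk n hn hkc hnc]
    · linarith [key m hm k hk hmc hkc]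
  · intro h ε hε
    obtain ⟨k, hk⟩ := exists_nat_one_div_lt hε
    obtain ⟨T, hT⟩ := exists_finset_rat_of_height_lt (k + 1)
    have hev : ∀ᶠ N in atTop, ∀ c ∈ T,
        (∀ n ≥ N, c < x n) ∨ (∀ n ≥ N, x n < c) ∨ ∀ n ≥ N, x n = c := by
      rw [Filter.eventually_all_finset]
      intro c _
      rcases h c with hc | hc | hc
      · filter_upwards [eventually_forall_ge_atTop.2 hc] with N hN using Or.inl hN
      · filter_upwards [eventually_forall_ge_atTop.2 hc] with N hN using Or.inr (Or.inl hN)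
      · filter_upwards [eventually_forall_ge_atTop.2 hc] with N hN using Or.inr (Or.inr hN)
    obtain ⟨N, hN⟩ := hev.exists
    refine ⟨N, fun m hm n hn => (dmet_le_one_div (by positivity) ?_).trans_lt hk⟩
    intro hne p q hq h₁ h₂
    by_contra! hlt
    have hle : min (x m) (x n) ≤ (p : ℚ) / q := by exact_mod_cast h₁
    have hge : (p : ℚ) / q ≤ max (x m) (x n) := by exact_mod_cast h₂
    rcases hN _ (hT p q (by exact_mod_cast hlt)) with hc | hc | hc
    · exact (lt_min (hc m hm) (hc n hn)).not_ge hle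
    · exact (max_lt (hc m hm) (hc n hn)).not_ge hge
    · exact hne (by rw [hc m hm, hc n hn])

/-- A sequence of rationals that is eventually on one side of every rational tends to `+∞`, to
`-∞`, or to a real number. -/
theorem tendsto_atTop_or_atBot_or_nhds_of_eventually {x : ℕ → ℚ}
    (h : ∀ c : ℚ, (∀ᶠ n in atTop, c < x n) ∨ ∀ᶠ n in atTop, x n < c) :
    Tendsto (fun n => (x n : ℝ)) atTop atTop ∨ Tendsto (fun n => (x n : ℝ)) atTop atBot ∨
      ∃ l : ℝ, Tendsto (fun n => (x n : ℝ)) atTop (nhds l) := by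
  by_cases htop : ∀ c : ℚ, ∀ᶠ n in atTop, c < x n
  · refine Or.inl (tendsto_atTop.2 fun b => ?_)
    obtain ⟨c, hc⟩ := exists_rat_gt b
    filter_upwards [htop c] with n hn
    exact hc.le.trans (by exact_mod_cast hn.le)
  by_cases hbot : ∀ c : ℚ, ∀ᶠ n in atTop, x n < c
  · refine Or.inr (Or.inl (tendsto_atBot.2 fun b => ?_))
    obtain ⟨c, hc⟩ := exists_rat_lt b
    filter_upwards [hbot c] with n hn
    exact le_trans (by exact_mod_cast hn.le) hc.le
  obtain ⟨u, hu⟩ := not_forall.1 htop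
  obtain ⟨v, hv⟩ := not_forall.1 hbot
  have hv' := (h v).resolve_right hv
  have hu' := (h u).resolve_left hu
  set S : Set ℝ := {s | ∃ c : ℚ, (∀ᶠ n in atTop, c < x n) ∧ (c : ℝ) = s} with hS
  have hne : S.Nonempty := ⟨v, v, hv', rfl⟩
  have hbdd : BddAbove S := by
    refine ⟨u, ?_⟩
    rintro _ ⟨c, hc, rfl⟩
    obtain ⟨n, h₁, h₂⟩ := (hc.and hu').exists
    exact_mod_cast (h₁.trans h₂).le
  refine Or.inr (Or.inr ⟨sSup S, tendsto_order.2 ⟨fun a ha => ?_, fun a ha => ?_⟩⟩)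
  · obtain ⟨_, ⟨c, hc, rfl⟩, hac⟩ := exists_lt_of_lt_csSup hne ha
    filter_upwards [hc] with n hn
    exact hac.trans (by exact_mod_cast hn)
  · obtain ⟨c, hc, hca⟩ := exists_rat_btwn ha
    have hcx := (h c).resolve_left fun hc' => (le_csSup hbdd ⟨c, hc', rfl⟩).not_gt hc
    filter_upwards [hcx] with n hn
    exact lt_trans (by exact_mod_cast hn) hca

/-- A real limit decides the eventual position relative to every other rational. -/
theorem eventually_lt_or_gt_of_tendsto {x : ℕ → ℚ} {l : ℝ}
    (h : Tendsto (fun n => (x n : ℝ)) atTop (nhds l)) {c : ℚ} (hc : (c : ℝ) ≠ l) :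
    (∀ᶠ n in atTop, c < x n) ∨ ∀ᶠ n in atTop, x n < c := by
  rcases hc.lt_or_gt with hc | hc
  · exact Or.inl ((h.eventually_const_lt hc).mono fun n hn => by exact_mod_cast hn)
  · exact Or.inr ((h.eventually_lt_const hc).mono fun n hn => by exact_mod_cast hn)

/-- Characterization of the Cauchy sequences of rational numbers for the metric `d`. -/
theorem cauchySeq_dmet_iff (x : ℕ → ℚ) :
    (∀ ε : ℝ, 0 < ε → ∃ N : ℕ, ∀ m ≥ N, ∀ n ≥ N, dmet (x m : ℝ) (x n : ℝ) < ε) ↔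
    ((∃ l : ℝ, Irrational l ∧ Tendsto (fun n => (x n : ℝ)) atTop (nhds l)) ∨
     (∃ r : ℚ, Tendsto (fun n => (x n : ℝ)) atTop (nhds (r : ℝ)) ∧
        ∀ᶠ n in atTop, r < x n) ∨
     (∃ r : ℚ, Tendsto (fun n => (x n : ℝ)) atTop (nhds (r : ℝ)) ∧
        ∀ᶠ n in atTop, x n < r) ∨
     (∃ r : ℚ, ∀ᶠ n in atTop, x n = r) ∨
     Tendsto (fun n => (x n : ℝ)) atTop atTop ∨
     Tendsto (fun n => (x n : ℝ)) atTop atBot) := by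
  rw [cauchySeq_dmet_iff_eventually_trichotomy]
  constructor
  · intro h
    by_cases heq : ∃ r : ℚ, ∀ᶠ n in atTop, x n = r
    · exact Or.inr (Or.inr (Or.inr (Or.inl heq)))
    have h' : ∀ c : ℚ, (∀ᶠ n in atTop, c < x n) ∨ ∀ᶠ n in atTop, x n < c := fun c =>
      (h c).imp_right fun hc => hc.resolve_right fun hc => heq ⟨c, hc⟩
    rcases tendsto_atTop_or_atBot_or_nhds_of_eventually h' with ht | ht | ⟨l, hl⟩
    · tauto
    · tauto
    · by_cases hirr : Irrational l
      · exact Or.inl ⟨l, hirr, hl⟩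
      · obtain ⟨r, rfl⟩ := not_not.1 hirr
        rcases h' r with hr | hr
        · exact Or.inr (Or.inl ⟨r, hl, hr⟩)
        · exact Or.inr (Or.inr (Or.inl ⟨r, hl, hr⟩))
  · rintro (⟨l, hirr, hl⟩ | ⟨r, hl, hr⟩ | ⟨r, hl, hr⟩ | ⟨r, hr⟩ | ht | ht) c
    · exact (eventually_lt_or_gt_of_tendsto hl (hirr.ne_rat c).symm).imp_right Or.inl
    · rcases eq_or_ne c r with rfl | hc
      · exact Or.inl hr
      · exact (eventually_lt_or_gt_of_tendsto hl (by exact_mod_cast hc)).imp_right Or.inl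
    · rcases eq_or_ne c r with rfl | hc
      · exact Or.inr (Or.inl hr)
      · exact (eventually_lt_or_gt_of_tendsto hl (by exact_mod_cast hc)).imp_right Or.inl
    · rcases lt_trichotomy c r with hc | rfl | hc
      · exact Or.inl (hr.mono fun n hn => hn ▸ hc)
      · exact Or.inr (Or.inr hr)
      · exact Or.inr (Or.inl (hr.mono fun n hn => hn ▸ hc))
    · exact Or.inl ((ht.eventually_gt_atTop (c : ℝ)).mono fun n hn => by exact_mod_cast hn)
    · exact Or.inr (Or.inl ((ht.eventually_lt_atBot (c : ℝ)).mono fun n hn => by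
        exact_mod_cast hn))
end

section
/- For every Farey interval I = [p/q, p'/q'] contained in [0,1], the δ-diameter of I ∖ ℚ equals 1/(q+q'), i.e. sup{δ(x,y) : x, y ∈ I, x ∉ ℚ, y ∉ ℚ} = 1/(q+q'); moreover the length of I is p'/q' − p/q = 1/(q q'). -/
/-- `[p/q, p'/q']` is a Farey interval: `p/q < p'/q'` are irreducible fractions with
`p'q - pq' = 1`. -/
def IsFareyPair (p : ℤ) (q : ℕ) (p' : ℤ) (q' : ℕ) : Prop :=
  0 < q ∧ 0 < q' ∧ Int.gcd p q = 1 ∧ Int.gcd p' q' = 1 ∧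
    (p : ℝ) / q < (p' : ℝ) / q' ∧ p' * (q : ℤ) - p * (q' : ℤ) = 1

/-- A rational strictly inside a Farey interval has denominator at least `q + q'`. -/
theorem IsFareyPair.add_le_den {p p' : ℤ} {q q' : ℕ} (hF : IsFareyPair p q p' q')
    {a : ℤ} {b : ℕ} (hb : 0 < b) (hl : (p : ℝ) / q < (a : ℝ) / b)
    (hr : (a : ℝ) / b < (p' : ℝ) / q') : q + q' ≤ b := by
  obtain ⟨hq, hq', -, -, -, hdet⟩ := hF
  rw [div_lt_div_iff₀ (by positivity) (by positivity)] at hl hr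
  have hl' : p * b < a * q := by exact_mod_cast hl
  have hr' : a * q' < p' * b := by exact_mod_cast hr
  have key : (b : ℤ) = q * (p' * b - a * q') + q' * (a * q - p * b) := by
    linear_combination (-(b : ℤ)) * hdet
  have h₁ : (q : ℤ) * 1 ≤ q * (p' * b - a * q') := by gcongr; lia
  have h₂ : (q' : ℤ) * 1 ≤ q' * (a * q - p * b) := by gcongr; lia
  lia

theorem IsFareyPair.gcd_mediant {p p' : ℤ} {q q' : ℕ} (hF : IsFareyPair p q p' q') :
    Int.gcd (p + p') ((q + q' : ℕ) : ℤ) = 1 := by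
  rw [← Int.isCoprime_iff_gcd_eq_one]
  refine ⟨q, -p, ?_⟩
  push_cast
  linear_combination hF.2.2.2.2.2

theorem IsFareyPair.lt_mediant {p p' : ℤ} {q q' : ℕ} (hF : IsFareyPair p q p' q') :
    (p : ℝ) / q < ((p + p' : ℤ) : ℝ) / (q + q' : ℕ) := by
  obtain ⟨hq, hq', -, -, -, hdet⟩ := hF
  rw [div_lt_div_iff₀ (by positivity) (by positivity)]
  exact_mod_cast (by push_cast; linarith : p * ((q + q' : ℕ) : ℤ) < (p + p') * q)

theorem IsFareyPair.mediant_lt {p p' : ℤ} {q q' : ℕ} (hF : IsFareyPair p q p' q') :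
    ((p + p' : ℤ) : ℝ) / (q + q' : ℕ) < (p' : ℝ) / q' := by
  obtain ⟨hq, hq', -, -, -, hdet⟩ := hF
  rw [div_lt_div_iff₀ (by positivity) (by positivity)]
  exact_mod_cast (by push_cast; linarith : (p + p') * q' < p' * ((q + q' : ℕ) : ℤ))

theorem Irrational.ne_intCast_div_natCast {x : ℝ} (hx : Irrational x) (a : ℤ) (b : ℕ) :
    (a : ℝ) / b ≠ x := by
  rintro rfl
  exact hx ⟨(a : ℚ) / b, by push_cast; rfl⟩

theorem le_deltamet {x y : ℝ} (hxy : x ≠ y) {a : ℤ} {b : ℕ} (hb : 0 < b)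
    (hab : Int.gcd a b = 1) (hl : min x y ≤ (a : ℝ) / b) (hr : (a : ℝ) / b ≤ max x y) :
    1 / (b : ℝ) ≤ deltamet x y := by
  rw [deltamet, if_neg hxy]
  refine le_csSup ⟨1, ?_⟩ ⟨b, hb, ⟨a, hab, hl, hr⟩, rfl⟩
  rintro r ⟨n, hn, -, rfl⟩
  exact div_le_one_of_le₀ (by exact_mod_cast hn) (by positivity)

theorem IsFareyPair.deltamet_le {p p' : ℤ} {q q' : ℕ} (hF : IsFareyPair p q p' q') {x y : ℝ}
    (hx : x ∈ Set.Icc ((p : ℝ) / q) ((p' : ℝ) / q')) (hxi : Irrational x)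
    (hy : y ∈ Set.Icc ((p : ℝ) / q) ((p' : ℝ) / q')) (hyi : Irrational y) :
    deltamet x y ≤ 1 / ((q : ℝ) + q') := by
  have hl : (p : ℝ) / q < min x y :=
    lt_min (lt_of_le_of_ne hx.1 (hxi.ne_intCast_div_natCast p q))
      (lt_of_le_of_ne hy.1 (hyi.ne_intCast_div_natCast p q))
  have hr : max x y < (p' : ℝ) / q' :=
    max_lt (lt_of_le_of_ne hx.2 (hxi.ne_intCast_div_natCast p' q').symm)
      (lt_of_le_of_ne hy.2 (hyi.ne_intCast_div_natCast p' q').symm)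
  have hq : (0 : ℝ) < q := by exact_mod_cast hF.1
  rw [deltamet]
  split_ifs
  · positivity
  · refine Real.sSup_le ?_ (by positivity)
    rintro r ⟨b, hb, ⟨a, -, hla, har⟩, rfl⟩
    have hden := hF.add_le_den hb (hl.trans_le hla) (har.trans_lt hr)
    exact one_div_le_one_div_of_le (by positivity) (by exact_mod_cast hden)

/-- For a Farey interval `I = [p/q, p'/q'] ⊆ [0,1]`, the `δ`-diameter of `I ∖ ℚ` is
`1/(q+q')`, and the length of `I` is `1/(qq')`. -/
theorem fareyInterval_diam_and_length (p p' : ℤ) (q q' : ℕ)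
    (hF : IsFareyPair p q p' q') (h0 : 0 ≤ (p : ℝ) / q) (h1 : (p' : ℝ) / q' ≤ 1) :
    sSup {t : ℝ | ∃ x y : ℝ, x ∈ Set.Icc ((p : ℝ) / q) ((p' : ℝ) / q') ∧ Irrational x ∧
        y ∈ Set.Icc ((p : ℝ) / q) ((p' : ℝ) / q') ∧ Irrational y ∧ t = deltamet x y} =
      1 / ((q : ℝ) + q') ∧
    (p' : ℝ) / q' - (p : ℝ) / q = 1 / ((q : ℝ) * q') := by
  have hq : (0 : ℝ) < q := by exact_mod_cast hF.1
  have hq' : (0 : ℝ) < q' := by exact_mod_cast hF.2.1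
  constructor
  · refine IsGreatest.csSup_eq ⟨?_, ?_⟩
    · obtain ⟨x, hxi, hxl, hxr⟩ := exists_irrational_btwn hF.lt_mediant
      obtain ⟨y, hyi, hyl, hyr⟩ := exists_irrational_btwn hF.mediant_lt
      have hx : x ∈ Set.Icc ((p : ℝ) / q) ((p' : ℝ) / q') :=
        ⟨hxl.le, (hxr.trans hF.mediant_lt).le⟩
      have hy : y ∈ Set.Icc ((p : ℝ) / q) ((p' : ℝ) / q') :=
        ⟨(hF.lt_mediant.trans hyl).le, hyr.le⟩
      refine ⟨x, y, hx, hxi, hy, hyi, le_antisymm ?_ (hF.deltamet_le hx hxi hy hyi)⟩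
      have h := le_deltamet (hxr.trans hyl).ne (Nat.add_pos_left hF.1 q') hF.gcd_mediant
        (min_le_of_left_le hxr.le) (le_max_of_le_right hyl.le)
      rwa [Nat.cast_add] at h
    · rintro t ⟨x, y, hx, hxi, hy, hyi, rfl⟩
      exact hF.deltamet_le hx hxi hy hyi
  · have hdet : (p' : ℝ) * q - p * q' = 1 := by exact_mod_cast hF.2.2.2.2.2
    field_simp
    linear_combination hdet
end

section
/- Let s be a real number with 1 < s < 2 and set ε = (2 − s)/(s − 1). Let q and q' be integers with 1 ≤ q < q' and q·q' ≤ q^(2+ε). Then (q + q')^(−s) > 1/(4 q q'), i.e. 4 q q' > (q + q')^s. -/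
/-- The key arithmetic inequality: if `1 < s < 2`, `ε = (2-s)/(s-1)`, and `1 ≤ q < q'`
are integers with `q·q' ≤ q^(2+ε)`, then `(q+q')^(-s) > 1/(4qq')`, i.e.
`4qq' > (q+q')^s`. -/
theorem farey_power_inequality (s ε : ℝ) (hs1 : 1 < s) (hs2 : s < 2)
    (hε : ε = (2 - s) / (s - 1)) (q q' : ℕ) (hq : 1 ≤ q) (hqq' : q < q')
    (hle : (q : ℝ) * q' ≤ (q : ℝ) ^ (2 + ε)) :
    1 / (4 * (q : ℝ) * q') < ((q : ℝ) + q') ^ (-s) ∧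
    ((q : ℝ) + q') ^ s < 4 * (q : ℝ) * q' := by
  have hs : 0 < s - 1 := by linarith
  have hq0 : (0 : ℝ) < q := by exact_mod_cast hq
  have hlt : (q : ℝ) < q' := by exact_mod_cast hqq'
  have hq'0 : (0 : ℝ) < q' := hq0.trans hlt
  have hexp : 2 + ε = 1 + (s - 1)⁻¹ := by
    rw [hε]
    field_simp
    ring
  have hq'le : (q' : ℝ) ≤ (q : ℝ) ^ (s - 1)⁻¹ := by
    rw [hexp, Real.rpow_add hq0, Real.rpow_one] at hle
    exact le_of_mul_le_mul_left hle hq0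
  have hroot : (q' : ℝ) ^ (s - 1) ≤ q := by
    calc (q' : ℝ) ^ (s - 1) ≤ ((q : ℝ) ^ (s - 1)⁻¹) ^ (s - 1) :=
          Real.rpow_le_rpow hq'0.le hq'le hs.le
      _ = q := Real.rpow_inv_rpow hq0.le hs.ne'
  have hmain : ((q : ℝ) + q') ^ s < 4 * (q : ℝ) * q' := by
    calc ((q : ℝ) + q') ^ s < (2 * (q' : ℝ)) ^ s :=
          Real.rpow_lt_rpow (by positivity) (by linarith) (by linarith)
      _ = 2 ^ s * ((q' : ℝ) ^ (s - 1) * q') := by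
          rw [Real.mul_rpow zero_le_two hq'0.le, ← Real.rpow_add_one hq'0.ne', sub_add_cancel]
      _ ≤ 2 ^ (2 : ℝ) * (q * q') := by
          gcongr
          exact one_le_two
      _ = 4 * (q : ℝ) * q' := by
          rw [Real.rpow_two]
          ring
  refine ⟨?_, hmain⟩
  rw [Real.rpow_neg (by positivity), one_div]
  exact inv_strictAnti₀ (by positivity) hmain
end
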